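/- arXiv:2602.12383 — 8 statements merged into one kernel-verified Lean document; each statement's English description precedes it below -/
import Mathlib

section
/- Let r₀ > 0 and m ∈ ℝ with m > −2r₀. Define w(x) = 1 + m/(2‖x‖) and φ(x) = (1 − r₀/‖x‖)/(1 + m/(2‖x‖)). Then the Lebesgue integral over the exterior region {x ∈ ℝ³ : ‖x‖ ≥ r₀} satisfies ∫_{‖x‖ ≥ r₀} w(x)² ‖∇φ(x)‖² dx = 4π (r₀ + m/2). (Thus the capacity of the coordinate sphere ‖x‖ = r₀ in the Schwarzschild manifold of mass m equals r₀ + m/2.) -/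
open scoped RealInnerProductSpace BigOperators
open MeasureTheory

noncomputable section

/-- Euclidean 3-space. -/
abbrev E3 : Type := EuclideanSpace ℝ (Fin 3)

/-- Divergence of a vector field: trace of its Fréchet derivative. -/
def div3 (X : E3 → E3) (x : E3) : ℝ :=
  ∑ i : Fin 3, fderiv ℝ X x (EuclideanSpace.single i 1) i

/-- Hessian of a function, viewed as a bilinear form. -/
def hess3 (u : E3 → ℝ) (x a b : E3) : ℝ :=
  fderiv ℝ (fun y => fderiv ℝ u y b) x a

/-- Laplacian: trace of the Hessian. -/
def lap3 (u : E3 → ℝ) (x : E3) : ℝ :=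
  ∑ i : Fin 3, hess3 u x (EuclideanSpace.single i 1) (EuclideanSpace.single i 1)

/-- The gradient of a radial function has norm equal to that of the radial derivative. -/
lemma norm_gradient_comp_norm {E : Type*} [NormedAddCommGroup E] [InnerProductSpace ℝ E]
    [CompleteSpace E] {f : ℝ → ℝ} {f' : ℝ} {x : E} (hx : x ≠ 0) (hf : HasDerivAt f f' ‖x‖) :
    ‖gradient (fun y : E => f ‖y‖) x‖ = |f'| := by
  have : Nontrivial E := ⟨⟨x, 0, hx⟩⟩
  have hn : DifferentiableAt ℝ (fun y : E => ‖y‖) x := differentiableAt_id.norm ℝ hx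
  have h : HasFDerivAt (fun y : E => f ‖y‖) (f' • fderiv ℝ (fun y : E => ‖y‖) x) x :=
    hf.comp_hasFDerivAt x hn.hasFDerivAt
  rw [gradient, LinearIsometryEquiv.norm_map, h.fderiv, norm_smul, norm_fderiv_norm hn, mul_one,
    Real.norm_eq_abs]

/-- Integration of a radial function over the exterior of a ball in `ℝ³`. -/
lemma setIntegral_exterior_fun_norm {r₀ : ℝ} (hr₀ : 0 < r₀) (f : ℝ → ℝ) :
    ∫ x in {x : E3 | r₀ ≤ ‖x‖}, f ‖x‖ = 4 * Real.pi * ∫ y in Set.Ioi r₀, y ^ 2 * f y := by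
  have hs : MeasurableSet {x : E3 | r₀ ≤ ‖x‖} := measurableSet_le measurable_const measurable_norm
  have hind : ({x : E3 | r₀ ≤ ‖x‖}.indicator fun x => f ‖x‖) =
      fun x : E3 => (Set.Ici r₀).indicator f ‖x‖ := by
    ext x
    simp [Set.indicator_apply]
  have hball : volume.real (Metric.ball (0 : E3) 1) = Real.pi * 4 / 3 := by
    rw [Measure.real, EuclideanSpace.volume_ball_fin_three]
    simp only [ENNReal.ofReal_one, one_pow, one_mul]
    exact ENNReal.toReal_ofReal (by positivity)
  have hrad : (fun y : ℝ => y ^ 2 * (Set.Ici r₀).indicator f y) =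
      (Set.Ici r₀).indicator fun y => y ^ 2 * f y := by
    ext y
    simp [Set.indicator_apply]
  rw [← integral_indicator hs, hind, integral_fun_norm_addHaar volume, hball]
  simp only [finrank_euclideanSpace, Fintype.card_fin, Nat.add_one_sub_one, smul_eq_mul,
    nsmul_eq_mul]
  rw [hrad, setIntegral_indicator measurableSet_Ici,
    Set.inter_eq_right.2 (Set.Ici_subset_Ioi.2 hr₀), integral_Ici_eq_integral_Ioi]
  push_cast
  ring

/-- The tail integral of an inverse square. -/
lemma integral_Ioi_inv_add_sq {a b : ℝ} (h : 0 < a + b) :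
    ∫ y in Set.Ioi a, ((y + b) ^ 2)⁻¹ = (a + b)⁻¹ := by
  have hderiv : ∀ y ∈ Set.Ici a, HasDerivAt (fun y => -(y + b)⁻¹) ((y + b) ^ 2)⁻¹ y := by
    intro y hy
    have hy0 : y + b ≠ 0 := by
      have : a ≤ y := hy
      linarith
    refine (((hasDerivAt_id' y).add_const b).fun_inv hy0).fun_neg.congr_deriv ?_
    simp [neg_div]
  have hlim : Filter.Tendsto (fun y : ℝ => -(y + b)⁻¹) Filter.atTop (nhds 0) := by
    simpa using (tendsto_inv_atTop_zero.comp
      (Filter.tendsto_atTop_add_const_right _ b Filter.tendsto_id)).neg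
  rw [integral_Ioi_of_hasDerivAt_of_nonneg' hderiv (fun y _ => by positivity) hlim]
  ring

/-- The capacity of the coordinate sphere `‖x‖ = r₀` in the Schwarzschild manifold of mass `m`
equals `r₀ + m/2`: the `g`-Dirichlet energy of the capacitary potential, written in Euclidean
terms as `∫_{‖x‖ ≥ r₀} w² ‖∇φ‖²`, equals `4π(r₀ + m/2)`. -/
theorem schwarzschild_capacity (r₀ m : ℝ) (hr₀ : 0 < r₀) (hm : m > -2 * r₀)
    (w : E3 → ℝ) (hw : ∀ x : E3, w x = 1 + m / (2 * ‖x‖))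
    (φ : E3 → ℝ) (hφ : ∀ x : E3, φ x = (1 - r₀ / ‖x‖) / (1 + m / (2 * ‖x‖))) :
    ∫ x in {x : E3 | r₀ ≤ ‖x‖}, (w x) ^ 2 * ‖gradient φ x‖ ^ 2
      = 4 * Real.pi * (r₀ + m / 2) := by
  obtain rfl : φ = fun x => (fun y => (1 - r₀ / y) / (1 + m / (2 * y))) ‖x‖ := funext hφ
  have hc : 0 < r₀ + m / 2 := by linarith
  have hderiv : ∀ y, r₀ ≤ y → HasDerivAt (fun y : ℝ => (1 - r₀ / y) / (1 + m / (2 * y)))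
      ((r₀ + m / 2) / (y + m / 2) ^ 2) y := by
    intro y hy
    have hy0 : 0 < y := hr₀.trans_le hy
    have hym : 0 < y + m / 2 := by linarith
    have hquot : HasDerivAt (fun y : ℝ => (y - r₀) / (y + m / 2))
        ((r₀ + m / 2) / (y + m / 2) ^ 2) y := by
      refine (((hasDerivAt_id' y).sub_const r₀).fun_div ((hasDerivAt_id' y).add_const (m / 2))
        hym.ne').congr_deriv ?_
      ring
    refine hquot.congr_of_eventuallyEq ?_
    filter_upwards [eventually_ne_nhds hy0.ne'] with z hz
    rw [← mul_div_mul_right _ _ hz]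
    congr 1 <;> field_simp
  have hint : ∀ x ∈ {x : E3 | r₀ ≤ ‖x‖},
      w x ^ 2 * ‖gradient (fun x : E3 => (fun y => (1 - r₀ / y) / (1 + m / (2 * y))) ‖x‖) x‖ ^ 2 =
        (fun y => (r₀ + m / 2) ^ 2 / (y ^ 2 * (y + m / 2) ^ 2)) ‖x‖ := by
    intro x hx
    have hx' : r₀ ≤ ‖x‖ := hx
    have hx0 : 0 < ‖x‖ := hr₀.trans_le hx'
    have hxm : 0 < ‖x‖ + m / 2 := by linarith
    have hwx : w x = (‖x‖ + m / 2) / ‖x‖ := by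
      rw [hw]
      field_simp
    rw [norm_gradient_comp_norm (norm_pos_iff.1 hx0) (hderiv _ hx'), sq_abs, hwx]
    field_simp
  have hrad : ∀ y ∈ Set.Ioi r₀, y ^ 2 * ((r₀ + m / 2) ^ 2 / (y ^ 2 * (y + m / 2) ^ 2)) =
      (r₀ + m / 2) ^ 2 * ((y + m / 2) ^ 2)⁻¹ := by
    intro y hy
    have hy0 : y ≠ 0 := (hr₀.trans hy).ne'
    rw [mul_div_assoc', mul_div_mul_left _ _ (pow_ne_zero 2 hy0), div_eq_mul_inv]
  rw [setIntegral_congr_fun (measurableSet_le measurable_const measurable_norm) hint,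
    setIntegral_exterior_fun_norm hr₀ fun y => (r₀ + m / 2) ^ 2 / (y ^ 2 * (y + m / 2) ^ 2),
    setIntegral_congr_fun measurableSet_Ioi hrad,
    integral_const_mul, integral_Ioi_inv_add_sq hc]
  field_simp
end
end

section
/- Let r₀ > 0. Suppose ψ : ℝ³ → ℝ is continuously differentiable, ψ(x) = 0 for every x with ‖x‖ = r₀, ψ(x) → 1 as ‖x‖ → ∞, and ‖∇ψ‖² is Lebesgue integrable on {x : ‖x‖ ≥ r₀}. Then ∫_{‖x‖ ≥ r₀} ‖∇ψ(x)‖² dx ≥ 4π r₀. (Hence the capacity of the sphere of radius r₀ in Euclidean ℝ³ equals r₀, the infimum being attained by φ(x) = 1 − r₀/‖x‖.) -/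
open scoped RealInnerProductSpace BigOperators
open MeasureTheory

noncomputable section

open Set Metric Module in
/-- Integration in polar coordinates for nonnegative measurable functions. -/
lemma lintegral_eq_lintegral_toSphere_lintegral_Ioi {E : Type*} [NormedAddCommGroup E]
    [NormedSpace ℝ E] [MeasurableSpace E] [BorelSpace E] [FiniteDimensional ℝ E] [Nontrivial E]
    (μ : Measure E) [μ.IsAddHaarMeasure] {g : E → ENNReal} (hg : Measurable g) :
    ∫⁻ x, g x ∂μ = ∫⁻ ω : sphere (0 : E) 1, (∫⁻ r in Ioi (0 : ℝ),
      ENNReal.ofReal (r ^ (finrank ℝ E - 1)) * g (r • (ω : E))) ∂μ.toSphere := by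
  have hmeas : Measurable fun p : sphere (0 : E) 1 × Ioi (0 : ℝ) ↦ g (p.2.1 • p.1.1) :=
    hg.comp (by fun_prop)
  calc
    ∫⁻ x, g x ∂μ = ∫⁻ x : ({0}ᶜ : Set E), g x ∂(μ.comap (↑)) := by
      rw [lintegral_subtype_comap (measurableSet_singleton _).compl g,
        restrict_compl_singleton]
    _ = ∫⁻ p, g (p.2.1 • p.1.1) ∂μ.toSphere.prod (.volumeIoiPow (finrank ℝ E - 1)) := by
      rw [← μ.measurePreserving_homeomorphUnitSphereProd.lintegral_comp hmeas]
      refine lintegral_congr fun x ↦ ?_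
      have := congrArg Subtype.val ((homeomorphUnitSphereProd E).symm_apply_apply x)
      rw [homeomorphUnitSphereProd_symm_apply_coe] at this
      rw [this]
    _ = _ := by
      rw [lintegral_prod _ hmeas.aemeasurable]
      refine lintegral_congr fun ω ↦ ?_
      have hray : Measurable fun r : Ioi (0 : ℝ) ↦ g (r.1 • ω.1) := hg.comp (by fun_prop)
      rw [Measure.volumeIoiPow, lintegral_withDensity_eq_lintegral_mul _ (by fun_prop) hray]
      exact lintegral_subtype_comap measurableSet_Ioi
        fun r : ℝ ↦ ENNReal.ofReal (r ^ (finrank ℝ E - 1)) * g (r • (ω : E))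

lemma volume_toSphere_univ_E3 :
    (volume : Measure E3).toSphere Set.univ = ENNReal.ofReal (4 * Real.pi) := by
  rw [Measure.toSphere_apply_univ, EuclideanSpace.volume_ball_fin_three]
  simp only [finrank_euclideanSpace, Fintype.card_fin, ENNReal.ofReal_one, one_pow, one_mul]
  rw [← ENNReal.ofReal_natCast, ← ENNReal.ofReal_mul (by positivity)]
  congr 1
  push_cast
  ring

/-- The gradient of a `C¹` function is continuous. -/
lemma ContDiff.continuous_gradient {E : Type*} [NormedAddCommGroup E] [InnerProductSpace ℝ E]
    [CompleteSpace E] {ψ : E → ℝ} (hψ : ContDiff ℝ 1 ψ) : Continuous (gradient ψ) :=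
  (InnerProductSpace.toDual ℝ E).symm.continuous.comp (hψ.continuous_fderiv one_ne_zero)

/-- The energy of a `C¹` function along a radial segment, weighted by `r ^ 2`, is bounded below in
terms of the values at the endpoints. -/
lemma radial_energy_lower_bound {E : Type*} [NormedAddCommGroup E] [InnerProductSpace ℝ E]
    [CompleteSpace E] {ψ : E → ℝ} (hψ : ContDiff ℝ 1 ψ) {ω : E} (hω : ‖ω‖ = 1) {a b : ℝ}
    (ha : 0 < a) (hab : a ≤ b) :
    2 * a * (ψ (b • ω) - ψ (a • ω)) - a + a ^ 2 / b ≤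
      ∫ r in a..b, r ^ 2 * ‖gradient ψ (r • ω)‖ ^ 2 := by
  have hgrad := hψ.continuous_gradient
  have hderiv : ∀ r ∈ Set.uIcc a b, HasDerivAt (fun r : ℝ ↦ 2 * a * ψ (r • ω) + a ^ 2 * r⁻¹)
      (2 * a * inner ℝ (gradient ψ (r • ω)) ω + a ^ 2 * -(r ^ 2)⁻¹) r := by
    intro r hr
    rw [Set.uIcc_of_le hab] at hr
    have hr0 : r ≠ 0 := (ha.trans_le hr.1).ne'
    have hray : HasDerivAt (fun r : ℝ ↦ r • ω) ω r := by
      simpa using (hasDerivAt_id r).smul_const ω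
    have hcomp := ((hψ.differentiable one_ne_zero
      (r • ω)).hasGradientAt.hasFDerivAt).comp_hasDerivAt r hray
    simp only [InnerProductSpace.toDual_apply_apply] at hcomp
    exact (hcomp.const_mul _).add ((hasDerivAt_inv hr0).const_mul _)
  have hcont : ContinuousOn
      (fun r : ℝ ↦ 2 * a * inner ℝ (gradient ψ (r • ω)) ω + a ^ 2 * -(r ^ 2)⁻¹)
      (Set.uIcc a b) := by
    have hinv : ContinuousOn (fun r : ℝ ↦ (r ^ 2)⁻¹) (Set.uIcc a b) := by
      refine ContinuousOn.inv₀ (by fun_prop) fun r hr ↦ ?_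
      rw [Set.uIcc_of_le hab] at hr
      exact pow_ne_zero 2 (ha.trans_le hr.1).ne'
    fun_prop
  calc
    _ = ∫ r in a..b, (2 * a * inner ℝ (gradient ψ (r • ω)) ω + a ^ 2 * -(r ^ 2)⁻¹) := by
      rw [intervalIntegral.integral_eq_sub_of_hasDerivAt hderiv hcont.intervalIntegrable]
      field_simp
      ring
    _ ≤ _ := by
      refine intervalIntegral.integral_mono_on hab hcont.intervalIntegrable
        (Continuous.intervalIntegrable (by fun_prop) _ _) fun r hr ↦ ?_
      have hr0 : 0 < r := ha.trans_le hr.1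
      have hinner : inner ℝ (gradient ψ (r • ω)) ω ≤ ‖gradient ψ (r • ω)‖ := by
        simpa [hω] using real_inner_le_norm (gradient ψ (r • ω)) ω
      have hsq := sq_nonneg (r * ‖gradient ψ (r • ω)‖ - a * r⁻¹)
      have hexpand : (r * ‖gradient ψ (r • ω)‖ - a * r⁻¹) ^ 2 =
          r ^ 2 * ‖gradient ψ (r • ω)‖ ^ 2 - 2 * a * ‖gradient ψ (r • ω)‖
            + a ^ 2 * (r ^ 2)⁻¹ := by
        field_simp
        ring
      have := mul_le_mul_of_nonneg_left hinner (by positivity : 0 ≤ 2 * a)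
      linarith

/-- The capacity of the sphere of radius `r₀` in Euclidean `ℝ³` equals `r₀`: any `C¹` function
vanishing on the sphere and tending to `1` at infinity, whose gradient is square-integrable
on the exterior region, has Dirichlet energy at least `4π r₀`. -/
theorem euclidean_sphere_capacity_lower_bound (r₀ : ℝ) (hr₀ : 0 < r₀)
    (ψ : E3 → ℝ) (hψ : ContDiff ℝ 1 ψ)
    (hbdry : ∀ x : E3, ‖x‖ = r₀ → ψ x = 0)
    (hinfty : ∀ ε : ℝ, 0 < ε → ∃ R : ℝ, ∀ x : E3, R ≤ ‖x‖ → |ψ x - 1| < ε)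
    (hint : IntegrableOn (fun x => ‖gradient ψ x‖ ^ 2) {x : E3 | r₀ ≤ ‖x‖}) :
    4 * Real.pi * r₀ ≤ ∫ x in {x : E3 | r₀ ≤ ‖x‖}, ‖gradient ψ x‖ ^ 2 := by
  have hgrad := hψ.continuous_gradient
  have hS : MeasurableSet {x : E3 | r₀ ≤ ‖x‖} := measurableSet_le measurable_const measurable_norm
  have hmeas : Measurable ({x : E3 | r₀ ≤ ‖x‖}.indicator
      fun x ↦ ENNReal.ofReal (‖gradient ψ x‖ ^ 2)) :=
    Measurable.indicator (hgrad.norm.pow 2).measurable.ennreal_ofReal hS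
  refine le_of_forall_pos_lt_add fun δ hδ ↦ ?_
  set ε : ℝ := δ / (16 * Real.pi * r₀) with hε
  have hεpos : 0 < ε := by positivity
  obtain ⟨R, hR⟩ := hinfty ε hεpos
  set b := max R r₀ with hb
  have hab : r₀ ≤ b := le_max_right _ _
  have hbpos : 0 < b := hr₀.trans_le hab
  have hray : ∀ ω : Metric.sphere (0 : E3) 1, ENNReal.ofReal (r₀ * (1 - 2 * ε)) ≤
      ∫⁻ r in Set.Ioi (0 : ℝ), ENNReal.ofReal (r ^ 2) *
        {x : E3 | r₀ ≤ ‖x‖}.indicator (fun x ↦ ENNReal.ofReal (‖gradient ψ x‖ ^ 2))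
          (r • (ω : E3)) := by
    intro ω
    have hω : ‖(ω : E3)‖ = 1 := by simp
    have hnorm : ∀ r : ℝ, 0 < r → ‖r • (ω : E3)‖ = r := fun r hr ↦ by
      rw [norm_smul, hω, mul_one, Real.norm_of_nonneg hr.le]
    have hend := (abs_lt.1 (hR (b • (ω : E3)) (by rw [hnorm b hbpos]; exact le_max_left _ _))).1
    have hstart : ψ (r₀ • (ω : E3)) = 0 := hbdry _ (hnorm r₀ hr₀)
    have hlow := radial_energy_lower_bound hψ hω hr₀ hab
    have hquot : 0 < r₀ ^ 2 / b := by positivity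
    calc
      _ ≤ ENNReal.ofReal (∫ r in r₀..b, r ^ 2 * ‖gradient ψ (r • (ω : E3))‖ ^ 2) := by
        refine ENNReal.ofReal_le_ofReal ?_
        rw [hstart] at hlow
        nlinarith
      _ = ∫⁻ r in Set.Ioc r₀ b, ENNReal.ofReal (r ^ 2 * ‖gradient ψ (r • (ω : E3))‖ ^ 2) := by
        rw [intervalIntegral.integral_of_le hab]
        refine ofReal_integral_eq_lintegral_ofReal ?_ (.of_forall fun r ↦ by positivity)
        exact (Continuous.intervalIntegrable (by fun_prop) r₀ b).1
      _ = ∫⁻ r in Set.Ioc r₀ b, ENNReal.ofReal (r ^ 2) *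
          {x : E3 | r₀ ≤ ‖x‖}.indicator (fun x ↦ ENNReal.ofReal (‖gradient ψ x‖ ^ 2))
            (r • (ω : E3)) := by
        refine setLIntegral_congr_fun measurableSet_Ioc fun r hr ↦ ?_
        have hmem : r • (ω : E3) ∈ {x : E3 | r₀ ≤ ‖x‖} := by
          rw [Set.mem_ofPred_eq, hnorm r (hr₀.trans hr.1)]
          exact hr.1.le
        simp only [Set.indicator_of_mem hmem]
        exact ENNReal.ofReal_mul (by positivity)
      _ ≤ _ := lintegral_mono_set fun r hr ↦ hr₀.trans hr.1
  have htotal : ENNReal.ofReal (r₀ * (1 - 2 * ε) * (4 * Real.pi)) ≤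
      ENNReal.ofReal (∫ x in {x : E3 | r₀ ≤ ‖x‖}, ‖gradient ψ x‖ ^ 2) := by
    rw [ofReal_integral_eq_lintegral_ofReal hint (.of_forall fun x ↦ by positivity),
      ← lintegral_indicator hS, lintegral_eq_lintegral_toSphere_lintegral_Ioi _ hmeas,
      ENNReal.ofReal_mul' (by positivity), ← volume_toSphere_univ_E3, ← lintegral_const]
    simpa only [finrank_euclideanSpace, Fintype.card_fin] using lintegral_mono hray
  have hreal := (ENNReal.ofReal_le_ofReal_iff (integral_nonneg fun x ↦ by positivity)).1 htotal
  have hδε : r₀ * (1 - 2 * ε) * (4 * Real.pi) = 4 * Real.pi * r₀ - δ / 2 := by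
    rw [hε]
    field_simp
    ring
  linarith
end
end

section
/- Let r₀ ∈ ℝ. Define φ(x) = 1 − r₀/‖x‖ and u(x) = −r₀²/(8‖x‖²) on ℝ³ ∖ {0}. Then for every x ≠ 0 and all vectors a, b ∈ ℝ³: Hess u(x)(a,b) − Δu(x)·⟨a,b⟩ = −⟨∇φ(x), a⟩·⟨∇φ(x), b⟩ + (1/2)‖∇φ(x)‖²·⟨a,b⟩. (That is, the exterior of a Euclidean ball is harmonic-static with respect to its capacitary potential, with potential u = −r₀²/(8r²).) -/
open scoped RealInnerProductSpace BigOperators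
open MeasureTheory

noncomputable section

section InnerProductSpace

variable {E : Type*} [NormedAddCommGroup E] [InnerProductSpace ℝ E]

/-- The derivative of `y ↦ (‖y‖²)⁻¹` away from the origin. -/
theorem hasFDerivAt_norm_sq_inv {x : E} (hx : x ≠ 0) :
    HasFDerivAt (fun y : E => (‖y‖ ^ 2)⁻¹) ((-2 / (‖x‖ ^ 2) ^ 2) • innerSL ℝ x) x := by
  have hs : ‖x‖ ^ 2 ≠ 0 := pow_ne_zero 2 (norm_ne_zero_iff.mpr hx)
  have h := (hasDerivAt_inv hs).comp_hasFDerivAt x (hasStrictFDerivAt_norm_sq x).hasFDerivAt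
  refine h.congr_fderiv ?_
  ext v
  simp
  ring

/-- The derivative of `y ↦ ‖y‖⁻¹` away from the origin. -/
theorem hasFDerivAt_norm_inv {x : E} (hx : x ≠ 0) :
    HasFDerivAt (fun y : E => ‖y‖⁻¹) ((-1 / ‖x‖ ^ 3) • innerSL ℝ x) x := by
  have hn : ‖x‖ ≠ 0 := norm_ne_zero_iff.mpr hx
  have hs : (‖x‖ ^ 2)⁻¹ ≠ 0 := inv_ne_zero (pow_ne_zero 2 hn)
  have h := (hasFDerivAt_norm_sq_inv hx).sqrt hs
  have hsqrt (y : E) : √(‖y‖ ^ 2)⁻¹ = ‖y‖⁻¹ := by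
    rw [Real.sqrt_inv, Real.sqrt_sq (norm_nonneg y)]
  simp only [hsqrt] at h
  refine h.congr_fderiv ?_
  ext v
  simp
  field_simp

end InnerProductSpace

/-- The Hessian of `c / ‖x‖²` away from the origin. -/
theorem hess3_const_mul_norm_sq_inv (c : ℝ) {x : E3} (hx : x ≠ 0) (a b : E3) :
    hess3 (fun y => c * (‖y‖ ^ 2)⁻¹) x a b
      = c * (8 * ⟪x, a⟫ * ⟪x, b⟫ / ‖x‖ ^ 6 - 2 * ⟪a, b⟫ / ‖x‖ ^ 4) := by
  have hn : ‖x‖ ≠ 0 := norm_ne_zero_iff.mpr hx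
  have hfst : (fun y : E3 => fderiv ℝ (fun z : E3 => c * (‖z‖ ^ 2)⁻¹) y b)
      =ᶠ[nhds x] fun y => (-2 * c) * (((‖y‖ ^ 2)⁻¹) ^ 2 * ⟪y, b⟫) := by
    filter_upwards [isOpen_ne.mem_nhds hx] with y hy
    rw [((hasFDerivAt_norm_sq_inv hy).const_mul c).fderiv]
    simp
    ring
  have hinner : HasFDerivAt (fun y : E3 => ⟪y, b⟫) (innerSL ℝ b) x := by
    simpa [real_inner_comm] using (innerSL ℝ b).hasFDerivAt (x := x)
  have hsnd := (((hasFDerivAt_norm_sq_inv hx).pow 2).mul hinner).const_mul (-2 * c)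
  simp only [Pi.mul_apply] at hsnd
  unfold hess3
  rw [hfst.fderiv_eq, hsnd.fderiv]
  simp [real_inner_comm a b]
  field_simp
  ring

/-- The Laplacian of `c / ‖x‖²` away from the origin. -/
theorem lap3_const_mul_norm_sq_inv (c : ℝ) {x : E3} (hx : x ≠ 0) :
    lap3 (fun y => c * (‖y‖ ^ 2)⁻¹) x = 2 * c / ‖x‖ ^ 4 := by
  have hn : ‖x‖ ≠ 0 := norm_ne_zero_iff.mpr hx
  have hsum : ‖x‖ ^ 2 = x 0 ^ 2 + x 1 ^ 2 + x 2 ^ 2 := by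
    simp [EuclideanSpace.real_norm_sq_eq, Fin.sum_univ_three]
  simp only [lap3, hess3_const_mul_norm_sq_inv c hx, Fin.sum_univ_three]
  simp [EuclideanSpace.inner_single_right]
  field_simp
  linear_combination (-8 * c) * hsum

/-- The gradient of `1 - r / ‖x‖` away from the origin. -/
theorem gradient_one_sub_div_norm (r : ℝ) {x : E3} (hx : x ≠ 0) :
    gradient (fun y : E3 => 1 - r / ‖y‖) x = (r / ‖x‖ ^ 3) • x := by
  refine HasGradientAt.gradient ?_
  rw [hasGradientAt_iff_hasFDerivAt]
  simp only [div_eq_mul_inv r ‖_‖]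
  refine (((hasFDerivAt_norm_inv hx).const_mul r).const_sub 1).congr_fderiv ?_
  ext v
  simp
  ring

/-- The exterior of a Euclidean ball is harmonic-static with respect to its capacitary
potential `φ = 1 - r₀/‖x‖`, with potential `u = -r₀²/(8‖x‖²)`. -/
theorem euclidean_exterior_harmonic_static (r₀ : ℝ)
    (φ : E3 → ℝ) (hφ : ∀ x : E3, φ x = 1 - r₀ / ‖x‖)
    (u : E3 → ℝ) (hu : ∀ x : E3, u x = -(r₀ ^ 2) / (8 * ‖x‖ ^ 2))
    (x : E3) (hx : x ≠ 0) (a b : E3) :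
    hess3 u x a b - lap3 u x * ⟪a, b⟫
      = -(⟪gradient φ x, a⟫ * ⟪gradient φ x, b⟫)
        + (1 / 2) * ‖gradient φ x‖ ^ 2 * ⟪a, b⟫ := by
  have hn : ‖x‖ ≠ 0 := norm_ne_zero_iff.mpr hx
  obtain rfl : φ = fun y => 1 - r₀ / ‖y‖ := funext hφ
  obtain rfl : u = fun y => (-(r₀ ^ 2) / 8) * (‖y‖ ^ 2)⁻¹ := by
    funext y
    rw [hu, div_mul_eq_div_div, div_eq_mul_inv _ (‖y‖ ^ 2)]
  rw [hess3_const_mul_norm_sq_inv _ hx, lap3_const_mul_norm_sq_inv _ hx,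
    gradient_one_sub_div_norm r₀ hx, norm_smul, mul_pow, Real.norm_eq_abs, sq_abs,
    real_inner_smul_left, real_inner_smul_left]
  field_simp
  ring
end
end

section
/- Let r₀ ∈ ℝ and define φ(x) = 1 − r₀/‖x‖ on ℝ³ ∖ {0}. Suppose v : ℝ³ ∖ {0} → ℝ is twice continuously differentiable, satisfies Hess v(x)(a,b) − Δv(x)·⟨a,b⟩ = −⟨∇φ(x), a⟩⟨∇φ(x), b⟩ + (1/2)‖∇φ(x)‖²⟨a,b⟩ for all x ≠ 0 and all a, b ∈ ℝ³, and v(x) → 0 as ‖x‖ → ∞. Then v(x) = −r₀²/(8‖x‖²) for all x ≠ 0. (The decaying solution of the harmonic-static equation on the punctured Euclidean space is unique.) -/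
open scoped RealInnerProductSpace BigOperators
open MeasureTheory

noncomputable section

/-- Tracing the harmonic-static equation determines the Laplacian, hence the full Hessian. -/
theorem hess3_eq_of_harmonic_static {v : E3 → ℝ} {x g : E3}
    (h : ∀ a b : E3, hess3 v x a b - lap3 v x * ⟪a, b⟫
      = -(⟪g, a⟫ * ⟪g, b⟫) + (1 / 2) * ‖g‖ ^ 2 * ⟪a, b⟫) (a b : E3) :
    hess3 v x a b = -(⟪g, a⟫ * ⟪g, b⟫) + (1 / 4) * ‖g‖ ^ 2 * ⟪a, b⟫ := by
  have hlap : lap3 v x = -(1 / 4) * ‖g‖ ^ 2 := by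
    have hdiag (i : Fin 3) := h (EuclideanSpace.single i 1) (EuclideanSpace.single i 1)
    have hnorm : ‖g‖ ^ 2 = g 0 ^ 2 + g 1 ^ 2 + g 2 ^ 2 := by
      rw [EuclideanSpace.real_norm_sq_eq, Fin.sum_univ_three]
    have hsum : lap3 v x = hess3 v x (EuclideanSpace.single 0 1) (EuclideanSpace.single 0 1)
        + hess3 v x (EuclideanSpace.single 1 1) (EuclideanSpace.single 1 1)
        + hess3 v x (EuclideanSpace.single 2 1) (EuclideanSpace.single 2 1) := by
      rw [lap3, Fin.sum_univ_three]
    simp only [EuclideanSpace.inner_single_right, PiLp.single_apply, if_true, map_one, one_mul,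
      conj_trivial, mul_one] at hdiag
    linarith [hdiag 0, hdiag 1, hdiag 2]
  have := h a b
  rw [hlap] at this
  linarith

/-- The gradient of the potential `1 - r₀ / ‖x‖` away from the origin. -/
theorem hasGradientAt_one_sub_div_norm {F : Type*} [NormedAddCommGroup F] [InnerProductSpace ℝ F]
    [CompleteSpace F] (r₀ : ℝ) {x : F} (hx : x ≠ 0) :
    HasGradientAt (fun y : F => 1 - r₀ / ‖y‖) ((r₀ / ‖x‖ ^ 3) • x) x := by
  have hn : ‖x‖ ≠ 0 := norm_ne_zero_iff.mpr hx
  have hsq : HasFDerivAt (fun y : F => ‖y‖ ^ 2) (2 • innerSL ℝ x) x :=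
    (hasStrictFDerivAt_norm_sq x).hasFDerivAt
  have hsqrt : HasDerivAt (fun s : ℝ => 1 - r₀ / √s)
      (r₀ / (2 * ‖x‖ ^ 3)) (‖x‖ ^ 2) := by
    have h1 := Real.hasDerivAt_sqrt (pow_ne_zero 2 hn)
    have h2 := ((h1.inv (by simpa using hn)).const_mul r₀).const_sub 1
    rw [Real.sqrt_sq (norm_nonneg x)] at h2
    simp only [div_eq_mul_inv r₀ √_]
    refine h2.congr_deriv ?_
    field_simp
  rw [hasGradientAt_iff_hasFDerivAt]
  have h := hsqrt.comp_hasFDerivAt x hsq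
  have hfun : ((fun s : ℝ => 1 - r₀ / √s) ∘ fun y : F => ‖y‖ ^ 2) = fun y => 1 - r₀ / ‖y‖ := by
    funext y
    simp [Real.sqrt_sq (norm_nonneg y)]
  rw [hfun] at h
  refine h.congr_fderiv ?_
  ext y
  simp
  field_simp

/-- A function on `(0, ∞)` with vanishing second derivative that tends to zero at infinity
vanishes. -/
theorem eq_zero_of_second_deriv_eq_zero_of_tendsto {f f' : ℝ → ℝ}
    (hf : ∀ t, 0 < t → HasDerivAt f (f' t) t) (hf' : ∀ t, 0 < t → HasDerivAt f' 0 t)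
    (hlim : Filter.Tendsto f Filter.atTop (nhds 0)) {t : ℝ} (ht : 0 < t) : f t = 0 := by
  have hconst {k : ℝ → ℝ} (hk : ∀ t, 0 < t → HasDerivAt k 0 t) {t : ℝ} (ht : 0 < t) :
      k t = k 1 :=
    isOpen_Ioi.is_const_of_deriv_eq_zero isPreconnected_Ioi
      (fun s hs => (hk s hs).differentiableAt.differentiableWithinAt)
      (fun s hs => (hk s hs).deriv) ht (Set.mem_Ioi.mpr one_pos)
  have haff {t : ℝ} (ht : 0 < t) : f t - f' 1 * t = f 1 - f' 1 * 1 := by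
    refine hconst (k := fun t => f t - f' 1 * t) (fun s hs => ?_) ht
    have h := (hf s hs).sub ((hasDerivAt_id s).const_mul (f' 1))
    rw [hconst hf' hs] at h
    exact h.congr_deriv (by simp)
  have hslope : f' 1 = 0 := by
    have h := (hlim.comp (Filter.tendsto_atTop_add_const_right _ 1 Filter.tendsto_id)).sub hlim
    rw [sub_zero] at h
    refine tendsto_nhds_unique (tendsto_const_nhds.congr' ?_) h
    filter_upwards [Filter.eventually_gt_atTop 0] with s hs
    have h1 := haff hs
    have h2 := haff (add_pos hs one_pos)
    simp only [Function.comp, id]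
    linarith
  refine tendsto_nhds_unique (tendsto_const_nhds.congr' ?_) hlim
  filter_upwards [Filter.eventually_gt_atTop 0] with s hs
  have h1 := haff hs
  have h2 := haff ht
  rw [hslope] at h1 h2
  linarith

/-- The decaying solution of the harmonic-static equation on punctured Euclidean space, with
respect to the capacitary potential `φ = 1 - r₀/‖x‖`, is unique: it is `-r₀²/(8‖x‖²)`. -/
theorem harmonic_static_decaying_solution_unique (r₀ : ℝ)
    (φ : E3 → ℝ) (hφ : ∀ x : E3, φ x = 1 - r₀ / ‖x‖)
    (v : E3 → ℝ) (hv : ContDiffOn ℝ 2 v {x : E3 | x ≠ 0})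
    (heq : ∀ x : E3, x ≠ 0 → ∀ a b : E3,
      hess3 v x a b - lap3 v x * ⟪a, b⟫
        = -(⟪gradient φ x, a⟫ * ⟪gradient φ x, b⟫)
          + (1 / 2) * ‖gradient φ x‖ ^ 2 * ⟪a, b⟫)
    (hdecay : ∀ ε : ℝ, 0 < ε → ∃ R : ℝ, ∀ x : E3, R ≤ ‖x‖ → |v x| < ε) :
    ∀ x : E3, x ≠ 0 → v x = -(r₀ ^ 2) / (8 * ‖x‖ ^ 2) := by
  intro x hx
  have hn : ‖x‖ ≠ 0 := norm_ne_zero_iff.mpr hx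
  have hxpos : 0 < ‖x‖ := norm_pos_iff.mpr hx
  obtain rfl : φ = fun y => 1 - r₀ / ‖y‖ := funext hφ
  have hray (t : ℝ) : HasDerivAt (fun s : ℝ => s • x) x t := by
    simpa using (hasDerivAt_id t).smul_const x
  have hsmooth (t : ℝ) (ht : 0 < t) : ContDiffAt ℝ 2 v (t • x) :=
    hv.contDiffAt (isOpen_ne.mem_nhds (smul_ne_zero ht.ne' hx))
  have hfirst (t : ℝ) (ht : 0 < t) :
      HasDerivAt (fun s : ℝ => v (s • x)) (fderiv ℝ v (t • x) x) t :=
    ((hsmooth t ht).differentiableAt (by norm_num)).hasFDerivAt.comp_hasDerivAt t (hray t)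
  have hhess (t : ℝ) (ht : 0 < t) :
      hess3 v (t • x) x x = -(3 / 4) * r₀ ^ 2 / (‖x‖ ^ 2 * t ^ 4) := by
    have htx : t • x ≠ 0 := smul_ne_zero ht.ne' hx
    rw [hess3_eq_of_harmonic_static (heq _ htx),
      (hasGradientAt_one_sub_div_norm r₀ htx).gradient]
    simp only [norm_smul, inner_smul_left, real_inner_self_eq_norm_sq, conj_trivial, norm_div,
      norm_pow, norm_mul, Real.norm_eq_abs, abs_of_pos ht, abs_norm, mul_pow, div_pow, sq_abs]
    field_simp
    ring
  have hsecond (t : ℝ) (ht : 0 < t) : HasDerivAt (fun s : ℝ => fderiv ℝ v (s • x) x)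
      (-(3 / 4) * r₀ ^ 2 / (‖x‖ ^ 2 * t ^ 4)) t := by
    rw [← hhess t ht]
    have hd : DifferentiableAt ℝ (fun y => fderiv ℝ v y x) (t • x) :=
      (((hsmooth t ht).fderiv_right (m := 1) (by norm_num)).differentiableAt
        (by norm_num)).clm_apply (differentiableAt_const x)
    exact hd.hasFDerivAt.comp_hasDerivAt t (hray t)
  set c : ℝ := r₀ ^ 2 / (8 * ‖x‖ ^ 2) with hc
  have hmodel (t : ℝ) (ht : 0 < t) :
      HasDerivAt (fun s : ℝ => c * (s ^ 2)⁻¹) (-2 * c * (t ^ 3)⁻¹) t := by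
    refine (((hasDerivAt_pow 2 t).inv (by positivity)).const_mul c).congr_deriv ?_
    field_simp
    norm_num
    ring
  have hmodel' (t : ℝ) (ht : 0 < t) :
      HasDerivAt (fun s : ℝ => -2 * c * (s ^ 3)⁻¹) (6 * c * (t ^ 4)⁻¹) t := by
    refine (((hasDerivAt_pow 3 t).inv (by positivity)).const_mul (-2 * c)).congr_deriv ?_
    field_simp
    norm_num
    ring
  have hvlim : Filter.Tendsto (fun t : ℝ => v (t • x)) Filter.atTop (nhds 0) := by
    rw [Metric.tendsto_nhds]
    intro ε hε
    obtain ⟨R, hR⟩ := hdecay ε hε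
    filter_upwards [Filter.eventually_ge_atTop (R / ‖x‖)] with t ht
    rw [Real.dist_eq, sub_zero]
    refine hR _ ?_
    rw [norm_smul, Real.norm_eq_abs]
    exact ((div_le_iff₀ hxpos).mp ht).trans (by gcongr; exact le_abs_self t)
  have hmodellim : Filter.Tendsto (fun t : ℝ => c * (t ^ 2)⁻¹) Filter.atTop (nhds 0) := by
    simpa using ((Filter.tendsto_pow_atTop two_ne_zero).inv_tendsto_atTop).const_mul c
  have hzero := eq_zero_of_second_deriv_eq_zero_of_tendsto
    (fun t ht => (hfirst t ht).add (hmodel t ht))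
    (fun t ht => ((hsecond t ht).add (hmodel' t ht)).congr_deriv (by rw [hc]; field_simp; ring))
    (by simpa only [add_zero] using! hvlim.add hmodellim) one_pos
  simp only [Pi.add_apply, one_smul, one_pow, inv_one, mul_one] at hzero
  rw [neg_div]
  linarith
end
end

section
/- Let m, r₀ ∈ ℝ. Define w(x) = 1 + m/(2‖x‖) and φ(x) = (1 − r₀/‖x‖)/(1 + m/(2‖x‖)). Then for every x ∈ ℝ³ with 2‖x‖ > |m| and x ≠ 0, and all vectors a, b ∈ ℝ³: −⟨∇φ(x), a⟩⟨∇φ(x), b⟩ + (1/2)‖∇φ(x)‖²·⟨a,b⟩ = ((2r₀ + m)²/(8‖x‖⁴ w(x)⁴)) · (⟨a,b⟩ − 2⟨x/‖x‖, a⟩⟨x/‖x‖, b⟩). (This is the coordinate form of the identity −dφ⊗dφ + (1/2)|∇φ|²_g g = ((r₀+m/2)²/(2r⁴(1+m/2r)⁴))(−dr² + r²dσ²) for the stress-energy tensor of the Schwarzschild capacitary potential.) -/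
open scoped RealInnerProductSpace BigOperators
open MeasureTheory

noncomputable section

/-- The norm of a real inner product space has gradient `x / ‖x‖` at every `x ≠ 0`. -/
theorem hasGradientAt_norm {F : Type*} [NormedAddCommGroup F] [InnerProductSpace ℝ F]
    [CompleteSpace F] {x : F} (hx : x ≠ 0) :
    HasGradientAt (fun y : F => ‖y‖) (‖x‖⁻¹ • x) x := by
  have hr : ‖x‖ ≠ 0 := norm_ne_zero_iff.mpr hx
  have h := (hasStrictFDerivAt_norm_sq x).hasFDerivAt.sqrt (pow_ne_zero 2 hr)
  simp only [Real.sqrt_sq (norm_nonneg _)] at h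
  rw [hasGradientAt_iff_hasFDerivAt]
  refine h.congr_fderiv ?_
  ext y
  simp
  field_simp

/-- Chain rule for the gradient of a radial function. -/
theorem HasDerivAt.hasGradientAt_comp_norm {F : Type*} [NormedAddCommGroup F]
    [InnerProductSpace ℝ F] [CompleteSpace F] {f : ℝ → ℝ} {f' : ℝ} {x : F} (hx : x ≠ 0)
    (hf : HasDerivAt f f' ‖x‖) :
    HasGradientAt (fun y : F => f ‖y‖) (f' • ‖x‖⁻¹ • x) x := by
  rw [hasGradientAt_iff_hasFDerivAt]
  refine (hf.comp_hasFDerivAt x (hasGradientAt_norm hx).hasFDerivAt).congr_fderiv ?_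
  simp

/-- Radial derivative of the Schwarzschild capacitary potential. -/
theorem hasDerivAt_schwarzschild_potential (m r₀ : ℝ) {r : ℝ} (hr : r ≠ 0)
    (hw : 1 + m / (2 * r) ≠ 0) :
    HasDerivAt (fun s : ℝ => (1 - r₀ / s) / (1 + m / (2 * s)))
      ((2 * r₀ + m) / (2 * r ^ 2 * (1 + m / (2 * r)) ^ 2)) r := by
  have hnum : HasDerivAt (fun s : ℝ => 1 - r₀ / s) (r₀ / r ^ 2) r := by
    refine (((hasDerivAt_const r r₀).div (hasDerivAt_id r) hr).const_sub 1).congr_deriv ?_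
    simp [neg_div]
  have hden : HasDerivAt (fun s : ℝ => 1 + m / (2 * s)) (-m / (2 * r ^ 2)) r := by
    refine (((hasDerivAt_const r m).div ((hasDerivAt_id r).const_mul 2)
      (mul_ne_zero two_ne_zero hr)).const_add 1).congr_deriv ?_
    simp
    field_simp
  refine (hnum.div hden hw).congr_deriv ?_
  field_simp
  ring

/-- Coordinate form of the stress-energy tensor of the Schwarzschild capacitary potential:
`-dφ⊗dφ + (1/2)|∇φ|² g = ((2r₀+m)²/(8r⁴w⁴)) (δ - 2 dr ⊗ dr)` in Euclidean terms. -/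
theorem schwarzschild_stress_energy (m r₀ : ℝ)
    (w : E3 → ℝ) (hw : ∀ x : E3, w x = 1 + m / (2 * ‖x‖))
    (φ : E3 → ℝ) (hφ : ∀ x : E3, φ x = (1 - r₀ / ‖x‖) / (1 + m / (2 * ‖x‖)))
    (x : E3) (hx : 2 * ‖x‖ > |m|) (hx0 : x ≠ 0) (a b : E3) :
    -(⟪gradient φ x, a⟫ * ⟪gradient φ x, b⟫) + (1 / 2) * ‖gradient φ x‖ ^ 2 * ⟪a, b⟫
      = ((2 * r₀ + m) ^ 2 / (8 * ‖x‖ ^ 4 * (w x) ^ 4))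
        * (⟪a, b⟫ - 2 * ⟪(‖x‖⁻¹ • x : E3), a⟫ * ⟪(‖x‖⁻¹ • x : E3), b⟫) := by
  have hr : 0 < ‖x‖ := norm_pos_iff.mpr hx0
  have hw0 : 1 + m / (2 * ‖x‖) ≠ 0 := by
    have hm : 0 < 2 * ‖x‖ + m := by linarith [neg_abs_le m]
    have heq : 1 + m / (2 * ‖x‖) = (2 * ‖x‖ + m) / (2 * ‖x‖) := by field_simp
    rw [heq]
    positivity
  have hgrad := ((hasDerivAt_schwarzschild_potential m r₀ hr.ne' hw0).hasGradientAt_comp_norm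
    hx0).gradient
  rw [← funext hφ, ← hw] at hgrad
  rw [← hw] at hw0
  have hunit : ‖(‖x‖⁻¹ • x : E3)‖ = 1 := norm_smul_inv_norm hx0
  rw [hgrad, norm_smul, hunit, mul_one, Real.norm_eq_abs, sq_abs,
    real_inner_smul_left _ a, real_inner_smul_left _ b]
  field_simp
  ring
end
end

section
/- Let m, r₀, C ∈ ℝ. Define w(r) = 1 + m/(2r) and u(r) = −(m + 2r₀)²/(32 r² w(r)²) + C·(1 − m/(2r))/(1 + m/(2r)) for r > 0. Then for every real r with 2r > |m| and r > 0, both of the following hold: (i) −4(w′(r)/w(r))·u′(r) − (2/r)·u′(r) + u(r)·(4w″(r)/w(r) + 4w′(r)/(r·w(r)) − 4(w′(r)/w(r))²) = −(2r₀+m)²/(8 r⁴ w(r)⁴); and (ii) −u″(r) − u′(r)/r + u(r)·(2w″(r)/w(r) + 6w′(r)/(r·w(r)) + 2(w′(r)/w(r))²) = (2r₀+m)²/(8 r⁴ w(r)⁴). (These are the dr² and r²dσ² components of the harmonic-static equation for a radial potential on the Schwarzschild manifold of mass m, so the Schwarzschild exterior is harmonic-static with respect to its capacitary potential.) -/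
noncomputable section

open Filter Topology

/-- First derivative of the Schwarzschild conformal factor. -/
theorem hasDerivAt_schwarzschild_factor (m : ℝ) {x : ℝ} (hx : x ≠ 0) :
    HasDerivAt (fun y : ℝ => 1 + m / (2 * y)) (-m / (2 * x ^ 2)) x := by
  have h := ((hasDerivAt_const x m).div ((hasDerivAt_id' x).const_mul 2)
    (mul_ne_zero two_ne_zero hx)).const_add 1
  refine h.congr_deriv ?_
  field_simp
  ring

/-- Second derivative of the Schwarzschild conformal factor. -/
theorem hasDerivAt_schwarzschild_factor_deriv (m : ℝ) {x : ℝ} (hx : x ≠ 0) :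
    HasDerivAt (fun y : ℝ => -m / (2 * y ^ 2)) (m / x ^ 3) x := by
  have h := (hasDerivAt_const x (-m)).div (((hasDerivAt_id' x).pow 2).const_mul 2)
    (mul_ne_zero two_ne_zero (pow_ne_zero 2 hx))
  refine h.congr_deriv ?_
  simp
  field_simp

/-- First derivative of the radial potential, written in terms of `2 * x + m`. -/
theorem hasDerivAt_radial_potential (m K C : ℝ) {x : ℝ} (hx : 2 * x + m ≠ 0) :
    HasDerivAt (fun y : ℝ => -K / (8 * (2 * y + m) ^ 2) + C * ((2 * y - m) / (2 * y + m)))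
      (K / (2 * (2 * x + m) ^ 3) + 4 * C * m / (2 * x + m) ^ 2) x := by
  have hs : HasDerivAt (fun y : ℝ => 2 * y + m) (2 * 1) x :=
    ((hasDerivAt_id' x).const_mul 2).add_const m
  have hd : HasDerivAt (fun y : ℝ => 2 * y - m) (2 * 1) x :=
    ((hasDerivAt_id' x).const_mul 2).sub_const m
  have h := ((hasDerivAt_const x (-K)).div ((hs.pow 2).const_mul 8)
    (mul_ne_zero (by norm_num) (pow_ne_zero 2 hx))).add ((hd.div hs hx).const_mul C)
  refine h.congr_deriv ?_
  simp
  field_simp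
  ring

/-- Second derivative of the radial potential, written in terms of `2 * x + m`. -/
theorem hasDerivAt_radial_potential_deriv (m K C : ℝ) {x : ℝ} (hx : 2 * x + m ≠ 0) :
    HasDerivAt (fun y : ℝ => K / (2 * (2 * y + m) ^ 3) + 4 * C * m / (2 * y + m) ^ 2)
      (-3 * K / (2 * x + m) ^ 4 - 16 * C * m / (2 * x + m) ^ 3) x := by
  have hs : HasDerivAt (fun y : ℝ => 2 * y + m) (2 * 1) x :=
    ((hasDerivAt_id' x).const_mul 2).add_const m
  have h := ((hasDerivAt_const x K).div ((hs.pow 3).const_mul 2)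
    (mul_ne_zero two_ne_zero (pow_ne_zero 3 hx))).add
    ((hasDerivAt_const x (4 * C * m)).div (hs.pow 2) (pow_ne_zero 2 hx))
  refine h.congr_deriv ?_
  simp
  field_simp
  ring

/-- The Schwarzschild exterior is harmonic-static with respect to its capacitary potential:
the radial function `u(r) = -(m+2r₀)²/(32r²w²) + C(1-m/(2r))/(1+m/(2r))` solves both the
`dr²` and `r²dσ²` components of the harmonic-static equation for the conformally flat metric
`g = w⁴δ`, `w(r) = 1 + m/(2r)`. -/
theorem schwarzschild_harmonic_static (m r₀ C : ℝ)
    (w : ℝ → ℝ) (hw : ∀ r : ℝ, w r = 1 + m / (2 * r))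
    (u : ℝ → ℝ) (hu : ∀ r : ℝ,
      u r = -(m + 2 * r₀) ^ 2 / (32 * r ^ 2 * (w r) ^ 2)
        + C * ((1 - m / (2 * r)) / (1 + m / (2 * r))))
    (r : ℝ) (hr : 2 * r > |m|) (hr0 : 0 < r) :
    (-4 * (deriv w r / w r) * deriv u r - (2 / r) * deriv u r
        + u r * (4 * deriv (deriv w) r / w r + 4 * deriv w r / (r * w r)
          - 4 * (deriv w r / w r) ^ 2)
      = -(2 * r₀ + m) ^ 2 / (8 * r ^ 4 * (w r) ^ 4)) ∧
    (-(deriv (deriv u) r) - deriv u r / r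
        + u r * (2 * deriv (deriv w) r / w r + 6 * deriv w r / (r * w r)
          + 2 * (deriv w r / w r) ^ 2)
      = (2 * r₀ + m) ^ 2 / (8 * r ^ 4 * (w r) ^ 4)) := by
  have hpos : 0 < 2 * r + m := by linarith [neg_abs_le m]
  have hr_ne : r ≠ 0 := hr0.ne'
  have hs_ne : 2 * r + m ≠ 0 := hpos.ne'
  have ev_ne : ∀ᶠ x in 𝓝 r, x ≠ 0 := eventually_ne_nhds hr_ne
  have ev_s : ∀ᶠ x in 𝓝 r, 2 * x + m ≠ 0 :=
    (by fun_prop : ContinuousAt (fun x : ℝ => 2 * x + m) r).eventually_ne hs_ne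
  have w_eq : ∀ x : ℝ, x ≠ 0 → w x = (2 * x + m) / (2 * x) := fun x hx => by
    rw [hw]
    field_simp
  have u_eq : ∀ x : ℝ, x ≠ 0 → 2 * x + m ≠ 0 →
      u x = -(m + 2 * r₀) ^ 2 / (8 * (2 * x + m) ^ 2) + C * ((2 * x - m) / (2 * x + m)) :=
    fun x hx hs => by
      have hsub : 1 - m / (2 * x) = (2 * x - m) / (2 * x) := by field_simp
      rw [hu, ← hw, w_eq x hx, hsub]
      field_simp
      ring
  have dw : ∀ x : ℝ, x ≠ 0 → deriv w x = -m / (2 * x ^ 2) := fun x hx => by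
    rw [funext hw]
    exact (hasDerivAt_schwarzschild_factor m hx).deriv
  have ddw : deriv (deriv w) r = m / r ^ 3 := by
    rw [EventuallyEq.deriv_eq (ev_ne.mono dw)]
    exact (hasDerivAt_schwarzschild_factor_deriv m hr_ne).deriv
  have u_ev := (ev_ne.and ev_s).mono fun x hx => u_eq x hx.1 hx.2
  have du_ev := u_ev.eventually_nhds.and ev_s |>.mono fun x hx =>
    (EventuallyEq.deriv_eq hx.1).trans
      (hasDerivAt_radial_potential m ((m + 2 * r₀) ^ 2) C hx.2).deriv
  have ddu := (EventuallyEq.deriv_eq du_ev).trans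
    (hasDerivAt_radial_potential_deriv m ((m + 2 * r₀) ^ 2) C hs_ne).deriv
  rw [ddu, du_ev.self_of_nhds, ddw, dw r hr_ne, u_eq r hr_ne hs_ne, w_eq r hr_ne]
  constructor
  · field_simp
    ring
  · field_simp
    ring
end
end

section
/- Let C ∈ ℝ and define u(r) = C·sin r + (1/8)(3 − 1/(cos r)²) + (3/8)·sin r·(log(cos r) − log(1 + sin r)) for r ∈ (−π/2, π/2). Then for every r ∈ (−π/2, π/2), both of the following hold: (i) tan(r)·u′(r) − u(r) = −(1/4)·(cos r)⁻⁴; and (ii) −u″(r) + tan(r)·u′(r) − 2u(r) = (1/2)·(cos r)⁻⁴. (These are the dr² and dσ² components of the harmonic-static equation on the unit round 3-sphere with poles removed, g = dr² + cos²(r) dσ², with respect to the g-harmonic function φ(r) = tan r; hence this metric is harmonic-static.) -/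
open Real

noncomputable section

/-- The derivative of `log (cos r) - log (1 + sin r)` is `-sec r`. -/
theorem hasDerivAt_log_cos_sub_log_one_add_sin {r : ℝ} (hc : cos r ≠ 0) (hs : 1 + sin r ≠ 0) :
    HasDerivAt (fun x => log (cos x) - log (1 + sin x)) (-(1 / cos r)) r := by
  refine (((hasDerivAt_cos r).log hc).sub
    (((hasDerivAt_sin r).const_add 1).log hs)).congr_deriv ?_
  field_simp
  linear_combination -(sin_sq_add_cos_sq r)

theorem one_add_sin_pos_of_cos_pos {r : ℝ} (hc : 0 < cos r) : 0 < 1 + sin r := by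
  nlinarith [sin_sq_add_cos_sq r, neg_one_le_sin r, sin_le_one r]

/-- The unit round 3-sphere with poles removed, `g = dr² + cos²(r)dσ²`, is harmonic-static
with respect to the `g`-harmonic function `φ = tan r`: the potential
`u(r) = C sin r + (1/8)(3 - sec² r) + (3/8) sin r (log(cos r) - log(1 + sin r))`
solves the `dr²` and `dσ²` components of the harmonic-static equation. -/
theorem sphere_harmonic_static (C : ℝ)
    (u : ℝ → ℝ) (hu : ∀ r : ℝ,
      u r = C * sin r + (1 / 8) * (3 - 1 / (cos r) ^ 2)
        + (3 / 8) * sin r * (log (cos r) - log (1 + sin r)))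
    (r : ℝ) (hr : r ∈ Set.Ioo (-(π / 2)) (π / 2)) :
    (tan r * deriv u r - u r = -(1 / 4) * (1 / (cos r) ^ 4)) ∧
    (-(deriv (deriv u) r) + tan r * deriv u r - 2 * u r = (1 / 2) * (1 / (cos r) ^ 4)) := by
  have h_first : ∀ x ∈ Set.Ioo (-(π / 2)) (π / 2), HasDerivAt u
      (C * cos x - (1 / 4) * (sin x / cos x ^ 3)
        + (3 / 8) * (cos x * (log (cos x) - log (1 + sin x)) - sin x / cos x)) x := by
    intro x hx
    have hc := cos_pos_of_mem_Ioo hx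
    have hL := hasDerivAt_log_cos_sub_log_one_add_sin hc.ne' (one_add_sin_pos_of_cos_pos hc).ne'
    have hsec := ((hasDerivAt_cos x).pow 2).inv (pow_ne_zero 2 hc.ne')
    have h := (((hasDerivAt_sin x).const_mul C).add ((hsec.const_sub 3).const_mul (1 / 8))).add
      (((hasDerivAt_sin x).const_mul (3 / 8)).mul hL)
    refine (h.congr_of_eventuallyEq (.of_forall fun y => ?_)).congr_deriv ?_
    · simp [hu]
    · simp only [Pi.pow_apply]
      field_simp
      ring
  have hc := cos_pos_of_mem_Ioo hr
  have hL := hasDerivAt_log_cos_sub_log_one_add_sin hc.ne' (one_add_sin_pos_of_cos_pos hc).ne'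
  have hcos := hasDerivAt_cos r
  have hsin := hasDerivAt_sin r
  have h_second : HasDerivAt (deriv u)
      (-(C * sin r) - (1 / 4) * ((cos r ^ 2 + 3 * sin r ^ 2) / cos r ^ 4)
        + (3 / 8) * (-(sin r * (log (cos r) - log (1 + sin r))) - 1 - 1 / cos r ^ 2)) r := by
    have h := ((hcos.const_mul C).sub
      ((hsin.div (hcos.pow 3) (pow_ne_zero 3 hc.ne')).const_mul (1 / 4))).add
      (((hcos.mul hL).sub (hsin.div hcos hc.ne')).const_mul (3 / 8))
    refine (h.congr_of_eventuallyEq ?_).congr_deriv ?_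
    · filter_upwards [isOpen_Ioo.mem_nhds hr] with x hx
      simpa using (h_first x hx).deriv
    · simp only [Pi.pow_apply]
      field_simp
      linear_combination (-12 * cos r ^ 4) * sin_sq_add_cos_sq r
  rw [h_second.deriv, (h_first r hr).deriv, hu r, tan_eq_sin_div_cos]
  constructor
  · field_simp
    linear_combination (-8 - 12 * cos r ^ 2) * sin_sq_add_cos_sq r
  · field_simp
    linear_combination (32 - 24 * cos r ^ 2) * sin_sq_add_cos_sq r
end
end

section
/- For every A > 0 and every H ≥ 0, there exists a unique pair (m, r) ∈ ℝ × ℝ with r > 0 and −2r < m ≤ 2r such that 4π r² (1 + m/(2r))⁴ = A and 2(1 − m/(2r)) = H · r · (1 + m/(2r))³. (That is, for every prescribed area A and constant mean curvature H ≥ 0, there is a unique mass m and coordinate radius r — with r ≥ m/2 when m > 0 and r > |m|/2 when m ≤ 0 — such that the coordinate sphere of radius r in the Schwarzschild manifold of mass m has area A and inward mean curvature H.) -/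
open Real

noncomputable section

/-- With conformal factor `s = 1 + m / (2 r)` and area radius `R = √(A / (4π))`, the area and mean
curvature equations amount to `r s² = R` and `s (2 + H R) = 4`. -/
theorem area_meanCurvature_iff {A H R r s : ℝ} (hR : 0 < R) (hA : 4 * π * R ^ 2 = A)
    (hr : 0 < r) :
    (4 * π * r ^ 2 * s ^ 4 = A ∧ 2 * (2 - s) = H * r * s ^ 3) ↔
      (r * s ^ 2 = R ∧ s * (2 + H * R) = 4) := by
  have area_iff : 4 * π * r ^ 2 * s ^ 4 = A ↔ r * s ^ 2 = R := by
    rw [← hA, ← pow_left_inj₀ (by positivity : 0 ≤ r * s ^ 2) hR.le two_ne_zero,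
      show 4 * π * r ^ 2 * s ^ 4 = 4 * π * (r * s ^ 2) ^ 2 by ring,
      mul_right_inj' (by positivity : 4 * π ≠ 0)]
  rw [area_iff, and_congr_right_iff]
  rintro rfl
  constructor <;> intro h <;> linear_combination -h

/-- For every prescribed area `A > 0` and constant mean curvature `H ≥ 0`, there is a unique
mass `m` and coordinate radius `r` (with `r > 0` and `-2r < m ≤ 2r`) such that the coordinate
sphere of radius `r` in the Schwarzschild manifold of mass `m` has area `A` and inward mean
curvature `H`. -/
theorem schwarzschild_sphere_data_exists_unique (A H : ℝ) (hA : 0 < A) (hH : 0 ≤ H) :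
    ∃! p : ℝ × ℝ, 0 < p.2 ∧ -2 * p.2 < p.1 ∧ p.1 ≤ 2 * p.2 ∧
      4 * π * p.2 ^ 2 * (1 + p.1 / (2 * p.2)) ^ 4 = A ∧
      2 * (1 - p.1 / (2 * p.2)) = H * p.2 * (1 + p.1 / (2 * p.2)) ^ 3 := by
  obtain ⟨R, hR, hRA⟩ : ∃ R : ℝ, 0 < R ∧ 4 * π * R ^ 2 = A := by
    refine ⟨√(A / (4 * π)), by positivity, ?_⟩
    rw [sq_sqrt (by positivity)]
    field_simp
  have hHR : 0 ≤ H * R := by positivity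
  have hden : 0 < 2 + H * R := by linarith
  obtain ⟨s, hs, hs2, hsH⟩ : ∃ s : ℝ, 0 < s ∧ s ≤ 2 ∧ s * (2 + H * R) = 4 := by
    refine ⟨4 / (2 + H * R), by positivity, ?_, by field_simp⟩
    rw [div_le_iff₀ hden]
    linarith
  have hr : 0 < R / s ^ 2 := by positivity
  refine ⟨(2 * (R / s ^ 2) * (s - 1), R / s ^ 2), ?_, ?_⟩
  · have hfactor : 2 * (R / s ^ 2) * (s - 1) / (2 * (R / s ^ 2)) = s - 1 :=
      mul_div_cancel_left₀ _ (by positivity)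
    have heq := (area_meanCurvature_iff hR hRA hr).2
      ⟨div_mul_cancel₀ R (by positivity : s ^ 2 ≠ 0), hsH⟩
    dsimp only
    rw [hfactor, add_sub_cancel, show 1 - (s - 1) = 2 - s by ring]
    exact ⟨hr, by nlinarith, by nlinarith, heq⟩
  · rintro ⟨m, r⟩ ⟨hr', -, -, harea, hcurv⟩
    dsimp only at hr' harea hcurv
    rw [show 1 - m / (2 * r) = 2 - (1 + m / (2 * r)) by ring] at hcurv
    obtain ⟨hrR, hH'⟩ := (area_meanCurvature_iff hR hRA hr').1 ⟨harea, hcurv⟩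
    have hs' : 1 + m / (2 * r) = s := mul_right_cancel₀ hden.ne' (hH'.trans hsH.symm)
    rw [hs'] at hrR
    have hreq : r = R / s ^ 2 := eq_div_of_mul_eq (by positivity) hrR
    have hmeq : m = 2 * r * (s - 1) := by
      rw [← hs']
      field_simp
      ring
    rw [hmeq, hreq]
end
end
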